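/- arXiv:1503.03879 — 2 statements merged into one kernel-verified Lean document; each statement's English description precedes it below -/
import Mathlib

section
/- Let G be a tree with vertex set V, let a, c ∈ V be distinct, and let Z1, Z2 ⊆ V \ {a, c} be such that: (Z1 ∪ Z2) ∩ path(a, c) = ∅; Z1 does not separate {a, c} from Z2 in G (i.e., some path in G from a or c to a vertex of Z2 avoids Z1); and Z2 does not separate {a, c} from Z1 in G. Then there exist symmetric positive definite real matrices Σ1 and Σ2 indexed by V×V, each Markov with respect to G, such that ρ²_{ac|Z1} computed from Σ1 is strictly greater than ρ²_{ac|Z2} computed from Σ1, and ρ²_{ac|Z2} computed from Σ2 is strictly greater than ρ²_{ac|Z1} computed from Σ2. -/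
open Matrix

variable {V : Type*}

/-- Partial covariance `σ_{uv|Z} = Σ_{uv} − Σ_{uZ} (Σ_{ZZ})⁻¹ Σ_{Zv}`. -/
noncomputable def pcov [Fintype V] [DecidableEq V] (S : Matrix V V ℝ) (u v : V) (Z : Finset V) : ℝ :=
  S u v - ∑ i : {x // x ∈ Z}, ∑ j : {x // x ∈ Z},
    S u (i : V) * (Matrix.of (fun i j : {x // x ∈ Z} => S (i : V) (j : V)))⁻¹ i j * S (j : V) v

/-- Squared partial correlation `ρ²_{uv|Z}`. -/
noncomputable def rho2 [Fintype V] [DecidableEq V] (S : Matrix V V ℝ) (u v : V) (Z : Finset V) : ℝ :=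
  pcov S u v Z ^ 2 / (pcov S u u Z * pcov S v v Z)
/-- `S` separates `A` from `C` in `G`: every path in `G` from a vertex of `A`
to a vertex of `C` contains a vertex of `S`. -/
def Separates {W : Type*} (G : SimpleGraph W) (A C S : Set W) : Prop :=
  ∀ ⦃a⦄, a ∈ A → ∀ ⦃c⦄, c ∈ C → ∀ p : G.Walk a c, p.IsPath → ∃ s ∈ S, s ∈ p.support

/-- `v` lies on the (unique, for a tree) path joining `x` and `y` in `G`. -/
def OnPath {W : Type*} (G : SimpleGraph W) (x y v : W) : Prop :=
  ∃ p : G.Walk x y, p.IsPath ∧ v ∈ p.support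

/-- `Σ` is Markov with respect to `G`: separation implies vanishing partial covariance. -/
def MarkovTree [Fintype V] [DecidableEq V] (G : SimpleGraph V) (S : Matrix V V ℝ) : Prop :=
  ∀ u v : V, u ≠ v → ∀ Z : Finset V, u ∉ Z → v ∉ Z →
    Separates G {u} {v} (↑Z : Set V) → pcov S u v Z = 0

namespace Matrix

variable [Fintype V]

theorem PosDef.eq_zero_of_forall_mul_mulVec_eq_zero {K : Matrix V V ℝ} (hK : K.PosDef) {q : V → ℝ}
    (h : ∀ i, q i * (K *ᵥ q) i ≤ 0) : q = 0 := by
  by_contra hq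
  have hpos := hK.dotProduct_mulVec_pos hq
  rw [star_trivial] at hpos
  exact absurd hpos (not_lt.mpr (Finset.sum_nonpos fun i _ => h i))

/-- If `K` has no entries linking `C` to the complement of `C ∪ Z`, then a vector vanishing on `Z`
that `K` annihilates outside `C ∪ Z` vanishes outside `C`. -/
theorem PosDef.eq_zero_of_notMem {K : Matrix V V ℝ} (hK : K.PosDef) {C Z : Set V}
    (hKC : ∀ i j, i ∉ C → i ∉ Z → j ∈ C → K i j = 0) {r : V → ℝ} (hrZ : ∀ i ∈ Z, r i = 0)
    (hr : ∀ i, i ∉ C → i ∉ Z → (K *ᵥ r) i = 0) {v : V} (hv : v ∉ C) : r v = 0 := by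
  classical
  have hq : (fun i => if i ∈ C then 0 else r i) = 0 := by
    refine hK.eq_zero_of_forall_mul_mulVec_eq_zero fun i => ?_
    by_cases hiC : i ∈ C
    · simp [hiC]
    by_cases hiZ : i ∈ Z
    · simp [hrZ i hiZ]
    have : (K *ᵥ fun i => if i ∈ C then 0 else r i) i = (K *ᵥ r) i := by
      refine Finset.sum_congr rfl fun j _ => ?_
      by_cases hj : j ∈ C
      · simp [hKC i j hiC hiZ hj]
      · simp [hj]
    rw [this, hr i hiC hiZ, mul_zero]
  simpa [hv] using congrFun hq v

/-- A minimum principle for positive definite matrices with nonpositive off-diagonal entries. -/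
theorem PosDef.nonneg_of_mulVec_nonneg {K : Matrix V V ℝ} (hK : K.PosDef)
    (hoff : ∀ i j, i ≠ j → K i j ≤ 0) {Z : Set V} {r : V → ℝ} (hrZ : ∀ i ∈ Z, 0 ≤ r i)
    (hr : ∀ i, i ∉ Z → 0 ≤ (K *ᵥ r) i) (v : V) : 0 ≤ r v := by
  have hq : (fun i => max (-r i) 0) = 0 := by
    refine hK.eq_zero_of_forall_mul_mulVec_eq_zero fun i => ?_
    rcases le_or_gt 0 (r i) with hi | hi
    · simp [hi]
    have hiZ : i ∉ Z := fun h => absurd (hrZ i h) (not_le.mpr hi)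
    refine mul_nonpos_of_nonneg_of_nonpos (le_max_right _ _) ?_
    have hle : (K *ᵥ fun i => max (-r i) 0) i ≤ -(K *ᵥ r) i := by
      simp only [mulVec, dotProduct]
      rw [← Finset.sum_neg_distrib]
      refine Finset.sum_le_sum fun j _ => ?_
      by_cases hij : i = j
      · subst hij
        rw [max_eq_left (by linarith)]
        linarith
      · nlinarith [hoff i j hij, le_max_left (-r j) 0]
    linarith [hr i hiZ]
  have := congrFun hq v
  simp only [Pi.zero_apply, max_eq_right_iff] at this
  linarith

end Matrix

section PartialCovariance

variable [Fintype V] [DecidableEq V]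

/-- The partial covariance expressed through regression coefficients `x` of `u` on `Z`. -/
theorem pcov_eq_of_regression {S : Matrix V V ℝ} (hS : S.PosDef) {u v : V} {Z : Finset V}
    {x : V → ℝ} (hx : ∀ i ∉ Z, x i = 0) (hreg : ∀ i ∈ Z, S i u = (S *ᵥ x) i) :
    pcov S u v Z = S v u - (S *ᵥ x) v := by
  have hsymm : ∀ i j, S i j = S j i := fun i j => by simpa using hS.isHermitian.apply j i
  set M : Matrix {x // x ∈ Z} {x // x ∈ Z} ℝ := Matrix.of fun i j => S i j with hM
  have hMdef : M.PosDef := hS.submatrix Subtype.val_injective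
  have hsum : ∀ w, (S *ᵥ x) w = ∑ j : {x // x ∈ Z}, S w j * x j := fun w => by
    rw [Finset.sum_coe_sort Z fun j => S w j * x j]
    refine (Finset.sum_subset (Finset.subset_univ Z) fun j _ hj => ?_).symm
    rw [hx j hj, mul_zero]
  have hrow : (fun i : {x // x ∈ Z} => S u i) = (fun i : {x // x ∈ Z} => x i) ᵥ* M := by
    ext i
    rw [hsymm, hreg i i.2, hsum]
    exact Finset.sum_congr rfl fun j _ => by rw [hsymm i j]; exact mul_comm _ _
  have hdouble : ∑ i : {x // x ∈ Z}, ∑ j : {x // x ∈ Z}, S u i * M⁻¹ i j * S j v =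
      ((fun i : {x // x ∈ Z} => S u i) ᵥ* M⁻¹) ⬝ᵥ fun j : {x // x ∈ Z} => S j v := by
    rw [Finset.sum_comm]
    simp only [vecMul, dotProduct, Finset.sum_mul]
  rw [pcov, hdouble, hrow, vecMul_vecMul,
    Matrix.mul_nonsing_inv _ ((Matrix.isUnit_iff_isUnit_det _).mp hMdef.isUnit), vecMul_one, hsum,
    hsymm u v]
  congr 1
  exact Finset.sum_congr rfl fun j _ => by rw [hsymm, mul_comm]

theorem exists_regression {S : Matrix V V ℝ} (hS : S.PosDef) (u : V) (Z : Finset V) :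
    ∃ x : V → ℝ, (∀ i ∉ Z, x i = 0) ∧ ∀ i ∈ Z, S i u = (S *ᵥ x) i := by
  set M : Matrix {x // x ∈ Z} {x // x ∈ Z} ℝ := Matrix.of fun i j => S i j with hM
  have hMdef : M.PosDef := hS.submatrix Subtype.val_injective
  let y : {x // x ∈ Z} → ℝ := M⁻¹ *ᵥ fun i => S i u
  refine ⟨fun i => if h : i ∈ Z then y ⟨i, h⟩ else 0, fun i hi => by simp [hi], fun i hi => ?_⟩
  have hy : M *ᵥ y = fun i : {x // x ∈ Z} => S i u := by
    rw [mulVec_mulVec, Matrix.mul_nonsing_inv _ ((Matrix.isUnit_iff_isUnit_det _).mp hMdef.isUnit),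
      one_mulVec]
  rw [← congrFun hy ⟨i, hi⟩]
  simp only [mulVec, dotProduct]
  rw [← Finset.sum_subset (Finset.subset_univ Z) fun j _ hj => by simp [hj],
    ← Finset.sum_coe_sort Z]
  exact Finset.sum_congr rfl fun j _ => by simp [hM]

theorem pcov_eq_of_forall_eq_zero {S : Matrix V V ℝ} (hS : S.PosDef) {u v : V} {Z : Finset V}
    (h : ∀ i ∈ Z, S i u = 0) : pcov S u v Z = S v u := by
  rw [pcov_eq_of_regression hS (x := 0) (by simp) (by simpa using h)]
  simp

theorem pcov_eq_of_forall_ne_eq_zero {S : Matrix V V ℝ} (hS : S.PosDef) {u v z : V} {Z : Finset V}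
    (hz : z ∈ Z) (hu : ∀ i ∈ Z, i ≠ z → S i u = 0) (hzero : ∀ i ∈ Z, i ≠ z → S i z = 0) :
    pcov S u v Z = S v u - S v z * (S z u / S z z) := by
  rw [pcov_eq_of_regression hS (x := Pi.single z (S z u / S z z))]
  · simp [div_eq_mul_inv]
  · intro i hi
    exact Pi.single_eq_of_ne (ne_of_mem_of_not_mem hz hi).symm _
  · intro i hi
    by_cases hiz : i = z
    · subst hiz
      have := hS.diag_pos (i := i)
      simp [field]
    · simp [hu i hi hiz, hzero i hi hiz]

/-- The global Markov property follows from the sparsity of the concentration matrix. -/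
theorem markovTree_inv {G : SimpleGraph V} {K : Matrix V V ℝ} (hK : K.PosDef)
    (hadj : ∀ i j, i ≠ j → ¬ G.Adj i j → K i j = 0) : MarkovTree G K⁻¹ := by
  intro u v huv Z huZ hvZ hsep
  obtain ⟨x, hx, hreg⟩ := exists_regression hK.inv u Z
  rw [pcov_eq_of_regression hK.inv hx hreg]
  have hKr : K *ᵥ (K⁻¹ *ᵥ (Pi.single u 1 - x)) = Pi.single u 1 - x := by
    rw [mulVec_mulVec, Matrix.mul_nonsing_inv _ ((Matrix.isUnit_iff_isUnit_det _).mp hK.isUnit),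
      one_mulVec]
  have hr : ∀ i, (K⁻¹ *ᵥ (Pi.single u 1 - x)) i = K⁻¹ i u - (K⁻¹ *ᵥ x) i := fun i => by
    simp [mulVec_sub]
  rw [← hr]
  let C : Set V := {w | ∃ p : G.Walk u w, ∀ s ∈ p.support, s ∉ Z}
  have huC : u ∈ C := ⟨.nil, by simpa using huZ⟩
  refine hK.eq_zero_of_notMem (C := C) (Z := Z) ?_ ?_ ?_ ?_
  · rintro i j hiC hiZ ⟨p, hp⟩
    refine hadj i j (fun h => hiC (h ▸ ⟨p, hp⟩)) fun hij => hiC ⟨p.concat hij.symm, fun s hs => ?_⟩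
    rw [SimpleGraph.Walk.support_concat, List.mem_append, List.mem_singleton] at hs
    rcases hs with hs | rfl
    exacts [hp s hs, hiZ]
  · intro i hi
    rw [hr, hreg i hi, sub_self]
  · intro i hiC hiZ
    rw [hKr, Pi.sub_apply, hx i hiZ, Pi.single_eq_of_ne (ne_of_mem_of_not_mem huC hiC).symm, sub_zero]
  · rintro ⟨p, hp⟩
    obtain ⟨s, hsZ, hs⟩ := hsep rfl rfl p.bypass p.bypass_isPath
    exact hp s (p.support_bypass_subset_support hs) hsZ

end PartialCovariance

section NonpositiveOffDiagonal

variable [Fintype V] [DecidableEq V] {K : Matrix V V ℝ}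

theorem mulVec_inv_col (hK : K.PosDef) (u : V) : K *ᵥ (fun i => K⁻¹ i u) = Pi.single u 1 := by
  have : (fun i => K⁻¹ i u) = K⁻¹ *ᵥ Pi.single u 1 := by ext; simp
  rw [this, mulVec_mulVec, Matrix.mul_nonsing_inv _
    ((Matrix.isUnit_iff_isUnit_det _).mp hK.isUnit), one_mulVec]

theorem mulVec_inv_col_nonneg (hK : K.PosDef) (u i : V) : 0 ≤ (K *ᵥ fun i => K⁻¹ i u) i := by
  rw [mulVec_inv_col hK, Pi.single_apply]
  split_ifs <;> simp

theorem inv_apply_nonneg (hK : K.PosDef) (hoff : ∀ i j, i ≠ j → K i j ≤ 0) (u v : V) :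
    0 ≤ K⁻¹ v u := by
  refine hK.nonneg_of_mulVec_nonneg hoff (Z := ∅) (r := fun i => K⁻¹ i u) (by simp) ?_ v
  exact fun i _ => mulVec_inv_col_nonneg hK u i

theorem inv_apply_mul_inv_apply_le (hK : K.PosDef) (hoff : ∀ i j, i ≠ j → K i j ≤ 0) (u v z : V) :
    K⁻¹ z u * K⁻¹ v z ≤ K⁻¹ z z * K⁻¹ v u := by
  rw [← sub_nonneg]
  refine hK.nonneg_of_mulVec_nonneg hoff (Z := {z})
    (r := fun i => K⁻¹ z z * K⁻¹ i u - K⁻¹ z u * K⁻¹ i z) ?_ ?_ v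
  · rintro i rfl
    exact le_of_eq (by ring)
  · intro i hi
    have : (fun i => K⁻¹ z z * K⁻¹ i u - K⁻¹ z u * K⁻¹ i z) =
        K⁻¹ z z • (fun i => K⁻¹ i u) - K⁻¹ z u • fun i => K⁻¹ i z := rfl
    rw [this, mulVec_sub, mulVec_smul, mulVec_smul, mulVec_inv_col hK z,
      Pi.sub_apply, Pi.smul_apply, Pi.smul_apply, Pi.single_eq_of_ne hi, smul_zero, sub_zero]
    exact smul_nonneg (inv_apply_nonneg hK hoff z z) (mulVec_inv_col_nonneg hK u i)

theorem inv_apply_pos_of_neg (hK : K.PosDef) (hoff : ∀ i j, i ≠ j → K i j ≤ 0) {u v w : V}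
    (hneg : K w v < 0) (hv : 0 < K⁻¹ v u) : 0 < K⁻¹ w u := by
  refine (inv_apply_nonneg hK hoff u w).lt_of_ne fun hw => ?_
  have h : (K *ᵥ fun i => K⁻¹ i u) w < 0 := by
    refine Finset.sum_neg' (fun j _ => ?_) ⟨v, Finset.mem_univ v, mul_neg_of_neg_of_pos hneg hv⟩
    by_cases hj : w = j
    · simp [← hj, ← hw]
    · exact mul_nonpos_of_nonpos_of_nonneg (hoff w j hj) (inv_apply_nonneg hK hoff u j)
  exact absurd h (not_lt.mpr (mulVec_inv_col_nonneg hK u w))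

theorem inv_apply_pos_of_walk {G : SimpleGraph V} {T : Set V} (hK : K.PosDef)
    (hoff : ∀ i j, i ≠ j → K i j ≤ 0) (hadj : ∀ i j, i ∈ T → j ∈ T → G.Adj i j → K i j < 0)
    {v w : V} (p : G.Walk v w) (hp : ∀ s ∈ p.support, s ∈ T) : 0 < K⁻¹ v w := by
  induction p with
  | nil => exact hK.inv.diag_pos
  | cons h p ih =>
    rw [SimpleGraph.Walk.support_cons] at hp
    exact inv_apply_pos_of_neg hK hoff (hadj _ _ (hp _ (by simp)) (hp _ (by simp)) h)
      (ih fun s hs => hp s (List.mem_cons_of_mem _ hs))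

end NonpositiveOffDiagonal

theorem Matrix.PosDef.apply_sq_lt_mul_diag [Fintype V] [DecidableEq V] {S : Matrix V V ℝ}
    (hS : S.PosDef) {u v : V} (huv : u ≠ v) : S u v ^ 2 < S u u * S v v := by
  have hsub : (S.submatrix ![u, v] ![u, v]).PosDef := hS.submatrix (by
    intro i j hij
    fin_cases i <;> fin_cases j <;> simp_all [eq_comm])
  have hdet := hsub.det_pos
  have hsymm : S v u = S u v := by simpa using hS.isHermitian.apply u v
  rw [Matrix.det_fin_two] at hdet
  simp only [submatrix_apply, cons_val_zero, cons_val_one, hsymm] at hdet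
  linarith

/-- Conditioning strictly decreases the squared correlation of two variables that are positively
associated with each other and with the conditioning variable. -/
theorem sq_partial_corr_lt {A C D x y w : ℝ} (hA : 0 < A) (hC : 0 < C) (hD : 0 < D) (hx : 0 < x)
    (hy : 0 < y) (hw : 0 < w) (hxAC : x ^ 2 < A * C) (hyAD : y ^ 2 < A * D) (hwCD : w ^ 2 < C * D)
    (hx' : y * w ≤ D * x) (hy' : x * w ≤ C * y) (hw' : x * y ≤ A * w) :
    (x - w * (y / D)) ^ 2 / ((A - y * (y / D)) * (C - w * (w / D))) < x ^ 2 / (A * C) := by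
  have hA' : 0 < D * A - y ^ 2 := by linarith
  have hC' : 0 < D * C - w ^ 2 := by linarith
  have heq : (x - w * (y / D)) ^ 2 / ((A - y * (y / D)) * (C - w * (w / D))) =
      (D * x - y * w) ^ 2 / ((D * A - y ^ 2) * (D * C - w ^ 2)) := by
    have h1 : A - y * (y / D) = (D * A - y ^ 2) / D := by field_simp
    have h2 : C - w * (w / D) = (D * C - w ^ 2) / D := by field_simp
    have h3 : x - w * (y / D) = (D * x - y * w) / D := by field_simp
    rw [h1, h2, h3]
    field_simp
  rw [heq, div_lt_div_iff₀ (mul_pos hA' hC') (mul_pos hA hC)]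
  have h1 : A * (D * x - y * w) ≤ x * (D * A - y ^ 2) := by nlinarith
  have h2 : C * (D * x - y * w) ≤ x * (D * C - w ^ 2) := by nlinarith
  have h0 : 0 ≤ D * x - y * w := by linarith
  have hprod : (A * (D * x - y * w)) * (C * (D * x - y * w)) <
      (x * (D * A - y ^ 2)) * (x * (D * C - w ^ 2)) := by
    rcases hw'.lt_or_eq with h | h
    · have : A * (D * x - y * w) < x * (D * A - y ^ 2) := by nlinarith
      exact mul_lt_mul_of_lt_of_le_of_nonneg_of_pos this h2 (mul_nonneg hA.le h0) (mul_pos hx hC')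
    · have hlt : x * w < C * y := by
        have : A * (x * w) < A * (C * y) := by
          calc A * (x * w) = x ^ 2 * y := by linear_combination -x * h
            _ < A * C * y := mul_lt_mul_of_pos_right hxAC hy
            _ = A * (C * y) := by ring
        exact lt_of_mul_lt_mul_left this hA.le
      have : C * (D * x - y * w) < x * (D * C - w ^ 2) := by nlinarith
      exact mul_lt_mul_of_le_of_lt_of_nonneg_of_pos h1 this (mul_nonneg hC.le h0) (mul_pos hx hA')
  linarith

/-- The first vertex of a walk lying in `Z`, together with the walk leading there. -/
theorem SimpleGraph.Walk.exists_first_mem {G : SimpleGraph V} (Z : Set V) {b e : V}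
    (p : G.Walk b e) (he : e ∈ Z) : ∃ z ∈ Z, ∃ q : G.Walk b z,
      (∀ s ∈ q.support, s ∈ p.support) ∧ ∀ s ∈ q.support, s ∈ Z → s = z := by
  induction p with
  | nil => exact ⟨_, he, .nil, by simp, by simp⟩
  | @cons b _ _ h p ih =>
    by_cases hb : b ∈ Z
    · exact ⟨b, hb, .nil, by simp, by simp⟩
    obtain ⟨z, hz, q, hqp, hqZ⟩ := ih he
    refine ⟨z, hz, .cons h q, fun s hs => ?_, fun s hs hsZ => ?_⟩ <;>
      rw [SimpleGraph.Walk.support_cons, List.mem_cons] at hs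
    · rw [SimpleGraph.Walk.support_cons, List.mem_cons]
      exact hs.imp_right (hqp s)
    · rcases hs with rfl | hs
      exacts [absurd hsZ hb, hqZ s hs hsZ]

/-- A Markov covariance matrix under which exactly the vertices of `T` are mutually dependent. -/
theorem exists_concentration [Fintype V] [DecidableEq V] (G : SimpleGraph V) (T : Set V) :
    ∃ K : Matrix V V ℝ, K.PosDef ∧ (∀ i j, i ≠ j → K i j ≤ 0) ∧
      (∀ i j, i ≠ j → ¬ G.Adj i j → K i j = 0) ∧ (∀ i j, i ∉ T → j ∈ T → K i j = 0) ∧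
      ∀ i j, i ∈ T → j ∈ T → G.Adj i j → K i j < 0 := by
  classical
  let H : SimpleGraph V :=
    { Adj := fun i j => G.Adj i j ∧ i ∈ T ∧ j ∈ T
      symm := ⟨fun i j h => ⟨h.1.symm, h.2.2, h.2.1⟩⟩
      loopless := ⟨fun i h => G.loopless.irrefl i h.1⟩ }
  have hentry : ∀ i j, i ≠ j → (1 + H.lapMatrix ℝ) i j =
      -(if G.Adj i j ∧ i ∈ T ∧ j ∈ T then 1 else 0) := fun i j hij => by
    simp [SimpleGraph.lapMatrix, SimpleGraph.degMatrix, SimpleGraph.adjMatrix_apply,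
      Matrix.one_apply_ne hij, Matrix.diagonal_apply_ne _ hij, H]
  refine ⟨1 + H.lapMatrix ℝ, Matrix.PosDef.one.add_posSemidef (H.posSemidef_lapMatrix ℝ),
    fun i j hij => ?_, fun i j hij h => ?_, fun i j hi hj => ?_, fun i j hi hj h => ?_⟩
  · rw [hentry i j hij]
    split_ifs <;> simp
  · simp [hentry i j hij, h]
  · simp [hentry i j fun h => hi (h ▸ hj), hi]
  · simp [hentry i j h.ne, h, hi, hj]

theorem exists_markovTree_rho2_lt_of_walks [Fintype V] [DecidableEq V] {G : SimpleGraph V}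
    {a c z : V} (hac : a ≠ c) {Z1 Z2 : Finset V} (haz : a ≠ z) (hcz : c ≠ z) (hz1 : z ∈ Z1)
    {T : Set V} (hT1 : ∀ s ∈ T, s ∈ Z1 → s = z) (hT2 : ∀ s ∈ T, s ∉ Z2)
    (p : G.Walk a c) (hp : ∀ s ∈ p.support, s ∈ T) (q : G.Walk a z) (hq : ∀ s ∈ q.support, s ∈ T) :
    ∃ S : Matrix V V ℝ, S.IsSymm ∧ S.PosDef ∧ MarkovTree G S ∧ rho2 S a c Z1 < rho2 S a c Z2 := by
  obtain ⟨K, hK, hoff, hsparse, hblock, hneg⟩ := exists_concentration G T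
  have hS := hK.inv
  have hsymm : ∀ i j, K⁻¹ i j = K⁻¹ j i := fun i j => by simpa using hS.isHermitian.apply j i
  refine ⟨K⁻¹, Matrix.IsSymm.ext fun i j => hsymm j i, hS, markovTree_inv hK hsparse, ?_⟩
  have haT : a ∈ T := hp a p.start_mem_support
  have hcT : c ∈ T := hp c p.end_mem_support
  have hzT : z ∈ T := hq z q.end_mem_support
  have hzero : ∀ i u, u ∈ T → i ∉ T → K⁻¹ i u = 0 := fun i u hu hi =>
    hK.eq_zero_of_notMem (C := T) (Z := ∅) (r := fun i => K⁻¹ i u)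
      (fun i j hi _ hj => hblock i j hi hj) (by simp)
      (fun i hi _ => by rw [mulVec_inv_col hK, Pi.single_eq_of_ne (ne_of_mem_of_not_mem hu hi).symm]) hi
  have hZ1 : ∀ u v, u ∈ T → pcov K⁻¹ u v Z1 = K⁻¹ v u - K⁻¹ v z * (K⁻¹ z u / K⁻¹ z z) :=
    fun u v hu => pcov_eq_of_forall_ne_eq_zero hS hz1
      (fun i hi hiz => hzero i u hu fun h => hiz (hT1 i h hi))
      (fun i hi hiz => hzero i z hzT fun h => hiz (hT1 i h hi))
  have hZ2 : ∀ u v, u ∈ T → pcov K⁻¹ u v Z2 = K⁻¹ v u := fun u v hu =>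
    pcov_eq_of_forall_eq_zero hS fun i hi => hzero i u hu fun h => hT2 i h hi
  have hwalk : ∀ s ∈ (p.reverse.append q).support, s ∈ T := fun s hs => by
    rw [SimpleGraph.Walk.mem_support_append_iff, SimpleGraph.Walk.support_reverse,
      List.mem_reverse] at hs
    exact hs.elim (hp s) (hq s)
  rw [rho2, rho2, hZ1 a c haT, hZ1 a a haT, hZ1 c c hcT, hZ2 a c haT, hZ2 a a haT, hZ2 c c hcT,
    hsymm c a, hsymm z a, hsymm z c]
  have hineq := inv_apply_mul_inv_apply_le hK hoff
  refine sq_partial_corr_lt hS.diag_pos hS.diag_pos hS.diag_pos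
    (inv_apply_pos_of_walk hK hoff hneg p hp) (inv_apply_pos_of_walk hK hoff hneg q hq)
    (inv_apply_pos_of_walk hK hoff hneg _ hwalk) (hS.apply_sq_lt_mul_diag hac)
    (hS.apply_sq_lt_mul_diag haz) (hS.apply_sq_lt_mul_diag hcz) ?_ ?_ ?_
  · simpa only [hsymm z a, hsymm c a, hsymm z c, mul_comm] using hineq a c z
  · simpa only [hsymm z a, hsymm c a, hsymm z c, mul_comm] using hineq a z c
  · simpa only [hsymm z a, hsymm c a, hsymm z c, mul_comm] using hineq c z a

theorem exists_markovTree_rho2_lt [Fintype V] [DecidableEq V] {G : SimpleGraph V}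
    (hG : G.Connected) {a c : V} (hac : a ≠ c) {Z1 Z2 : Finset V} (haZ1 : a ∉ Z1) (hcZ1 : c ∉ Z1)
    (hpath : ∀ v ∈ Z1 ∪ Z2, ¬ OnPath G a c v)
    (hns : ¬ Separates G {a, c} (↑Z1 : Set V) (↑Z2 : Set V)) :
    ∃ S : Matrix V V ℝ, S.IsSymm ∧ S.PosDef ∧ MarkovTree G S ∧ rho2 S a c Z1 < rho2 S a c Z2 := by
  obtain ⟨p, hp⟩ := hG.exists_isPath a c
  simp only [Separates, not_forall, not_exists, not_and] at hns
  obtain ⟨b, hb, e, he, r, -, hr⟩ := hns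
  obtain ⟨z, hz, q, hqr, hqz⟩ := r.exists_first_mem Z1 he
  let T : Set V := {s | (s ∈ Z1 → s = z) ∧ s ∉ Z2}
  have hpT : ∀ s ∈ p.support, s ∈ T := fun s hs =>
    ⟨fun h => absurd ⟨p, hp, hs⟩ (hpath s (Finset.mem_union_left _ h)),
      fun h => hpath s (Finset.mem_union_right _ h) ⟨p, hp, hs⟩⟩
  have hqT : ∀ s ∈ q.support, s ∈ T := fun s hs =>
    ⟨hqz s hs, fun h => hr s h (hqr s hs)⟩
  obtain ⟨q', hq'⟩ : ∃ q' : G.Walk a z, ∀ s ∈ q'.support, s ∈ T := by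
    rcases hb with rfl | rfl
    · exact ⟨q, hqT⟩
    · refine ⟨p.append q, fun s hs => ?_⟩
      rw [SimpleGraph.Walk.mem_support_append_iff] at hs
      exact hs.elim (hpT s) (hqT s)
  exact exists_markovTree_rho2_lt_of_walks hac (fun h => haZ1 (h ▸ hz)) (fun h => hcZ1 (h ▸ hz)) hz
    (fun s hs => hs.1) (fun s hs => hs.2) p hpT q' hq'

/-- Theorem 8, completeness: if neither `Z1` nor `Z2` separates
`{a,c}` from the other, and `(Z1 ∪ Z2)` avoids `path(a,c)`, then both strict
orderings of `ρ²_{ac|Z1}` and `ρ²_{ac|Z2}` are realised by Markov covariance matrices. -/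
theorem stmt_16 [Fintype V] [DecidableEq V] [Nonempty V]
    (G : SimpleGraph V) (hG : G.IsTree)
    (a c : V) (hac : a ≠ c)
    (Z1 Z2 : Finset V) (haZ1 : a ∉ Z1) (hcZ1 : c ∉ Z1) (haZ2 : a ∉ Z2) (hcZ2 : c ∉ Z2)
    (hpath : ∀ v ∈ Z1 ∪ Z2, ¬ OnPath G a c v)
    (hns1 : ¬ Separates G {a, c} (↑Z2 : Set V) (↑Z1 : Set V))
    (hns2 : ¬ Separates G {a, c} (↑Z1 : Set V) (↑Z2 : Set V)) :
    (∃ S1 : Matrix V V ℝ, S1.IsSymm ∧ S1.PosDef ∧ MarkovTree G S1 ∧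
        rho2 S1 a c Z2 < rho2 S1 a c Z1) ∧
    (∃ S2 : Matrix V V ℝ, S2.IsSymm ∧ S2.PosDef ∧ MarkovTree G S2 ∧
        rho2 S2 a c Z1 < rho2 S2 a c Z2) := by
  exact ⟨exists_markovTree_rho2_lt hG.connected hac haZ2 hcZ2
      (by rwa [Finset.union_comm]) hns1,
    exists_markovTree_rho2_lt hG.connected hac haZ1 hcZ1 hpath hns2⟩
end

section
/- Let G be a tree with vertex set V and let Σ be a symmetric positive definite real matrix indexed by V×V that is Markov with respect to G. Let a, c, c' ∈ V be distinct with c ∈ path(a, c'), and let Z, Z' ⊆ V \ {a, c, c'} be such that Z' separates {a, c'} from Z in G. Then ρ²_{ac'|Z'} ≤ ρ²_{ac|Z}. -/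
open Matrix

variable {V : Type*}

/-- `c` is the coefficient vector of the residual of coordinate `u` after linear regression on the
coordinates in `Z`, for the covariance matrix `S`. -/
def IsResidual [Fintype V] [DecidableEq V] (S : Matrix V V ℝ) (u : V) (Z : Finset V)
    (c : V → ℝ) : Prop :=
  (∀ i, i ∉ Z → c i = (Pi.single u 1 : V → ℝ) i) ∧ ∀ j ∈ Z, (c ᵥ* S) j = 0

lemma isUnit_det_of_posDef_restrict [DecidableEq V] {S : Matrix V V ℝ}
    (hpd : S.PosDef) (Z : Finset V) :
    IsUnit (Matrix.of (fun i j : {x // x ∈ Z} => S (i : V) (j : V))).det :=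
  (Matrix.isUnit_iff_isUnit_det _).1
    (hpd.submatrix (e := ((↑) : {x // x ∈ Z} → V)) Subtype.val_injective).isUnit

section PartialCovariance

variable [Fintype V] [DecidableEq V] {S : Matrix V V ℝ}

lemma exists_isResidual (hpd : S.PosDef) (u : V) (Z : Finset V) :
    ∃ c, IsResidual S u Z c ∧ ∀ v, pcov S u v Z = (c ᵥ* S) v := by
  set M := Matrix.of (fun i j : {x // x ∈ Z} => S (i : V) (j : V)) with hM
  set s : {x // x ∈ Z} → ℝ := fun i => S u i with hs
  set b : V → ℝ := fun i => if h : i ∈ Z then (s ᵥ* M⁻¹) ⟨i, h⟩ else 0 with hb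
  have key : ∀ v, ((Pi.single u 1 - b) ᵥ* S) v =
      S u v - ∑ j : {x // x ∈ Z}, (s ᵥ* M⁻¹) j * S j v := by
    intro v
    rw [sub_vecMul, Pi.sub_apply, single_one_vecMul]
    congr 1
    simp only [vecMul, dotProduct]
    rw [← Finset.sum_subset (Finset.subset_univ Z), ← Finset.sum_coe_sort]
    · refine Finset.sum_congr rfl fun j _ => ?_
      simp [hb, vecMul, dotProduct]
    · intro i _ hi
      simp [hb, hi]
  refine ⟨Pi.single u 1 - b, ⟨fun i hi => by simp [hb, hi], fun j hj => ?_⟩, fun v => ?_⟩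
  · have h : ((s ᵥ* M⁻¹) ᵥ* M) ⟨j, hj⟩ = s ⟨j, hj⟩ := by
      rw [vecMul_vecMul, nonsing_inv_mul _ (isUnit_det_of_posDef_restrict hpd Z), vecMul_one]
    rw [key, sub_eq_zero]
    exact h.symm
  · rw [key, pcov, Finset.sum_comm]
    simp only [vecMul, dotProduct, Finset.sum_mul, hs, hM]

lemma IsResidual.dotProduct_eq {u v : V} {Z : Finset V} {c d : V → ℝ}
    (hc : IsResidual S u Z c) (hd : IsResidual S v Z d) :
    (c ᵥ* S) ⬝ᵥ d = (c ᵥ* S) v := by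
  rw [← dotProduct_single_one (c ᵥ* S) v]
  refine Finset.sum_congr rfl fun i _ => ?_
  by_cases hi : i ∈ Z
  · simp [hc.2 i hi]
  · rw [hd.1 i hi]

lemma IsResidual.pcov_eq (hpd : S.PosDef) {u : V} {Z : Finset V} {c : V → ℝ}
    (hc : IsResidual S u Z c) (v : V) : pcov S u v Z = (c ᵥ* S) v := by
  obtain ⟨d, hd, h⟩ := exists_isResidual hpd u Z
  have h0 : ((c - d) ᵥ* S) ⬝ᵥ (c - d) = 0 := by
    refine Finset.sum_eq_zero fun i _ => ?_
    by_cases hi : i ∈ Z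
    · simp [sub_vecMul, hc.2 i hi, hd.2 i hi]
    · simp [hc.1 i hi, hd.1 i hi]
  have hcd : c - d = 0 := by
    by_contra hne
    have := hpd.dotProduct_mulVec_pos hne
    rw [star_trivial, dotProduct_mulVec, h0] at this
    exact this.false
  rw [h, sub_eq_zero.1 hcd]

lemma pcov_comm (hpd : S.PosDef) (hsym : S.IsSymm) (u v : V) (Z : Finset V) :
    pcov S u v Z = pcov S v u Z := by
  obtain ⟨c, hc, hc'⟩ := exists_isResidual hpd u Z
  obtain ⟨d, hd, hd'⟩ := exists_isResidual hpd v Z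
  rw [hc', hd', ← hc.dotProduct_eq hd, ← hd.dotProduct_eq hc, ← dotProduct_mulVec,
    dotProduct_comm, ← vecMul_transpose, hsym.eq, dotProduct_comm, dotProduct_comm]

lemma pcov_eq_zero_of_mem_left (hpd : S.PosDef) (hsym : S.IsSymm) {u : V} (v : V) {Z : Finset V}
    (hu : u ∈ Z) : pcov S u v Z = 0 := by
  obtain ⟨c, hc, hc'⟩ := exists_isResidual hpd v Z
  rw [pcov_comm hpd hsym, hc', hc.2 u hu]

lemma pcov_self_pos (hpd : S.PosDef) {u : V} {Z : Finset V} (hu : u ∉ Z) :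
    0 < pcov S u u Z := by
  obtain ⟨c, hc, hc'⟩ := exists_isResidual hpd u Z
  have hne : c ≠ 0 := by
    rintro rfl
    simpa using hc.1 u hu
  have := hpd.dotProduct_mulVec_pos hne
  rwa [star_trivial, dotProduct_mulVec, hc.dotProduct_eq hc, ← hc'] at this

lemma pcov_insert (hpd : S.PosDef) (u v : V) {w : V} {Z : Finset V} (hw : w ∉ Z) :
    pcov S u v (insert w Z) =
      pcov S u v Z - pcov S u w Z * pcov S w v Z / pcov S w w Z := by
  obtain ⟨c, hc, hc'⟩ := exists_isResidual hpd u Z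
  obtain ⟨d, hd, hd'⟩ := exists_isResidual hpd w Z
  have hpos := pcov_self_pos hpd hw
  have key : IsResidual S u (insert w Z) (c - (pcov S u w Z / pcov S w w Z) • d) := by
    refine ⟨fun i hi => ?_, fun j hj => ?_⟩
    · rw [Finset.mem_insert, not_or] at hi
      simp [hc.1 i hi.2, hd.1 i hi.2, hi.1]
    · rw [sub_vecMul, smul_vecMul, Pi.sub_apply, Pi.smul_apply, smul_eq_mul]
      rcases Finset.mem_insert.1 hj with rfl | hj
      · rw [← hc', ← hd', div_mul_cancel₀ _ hpos.ne', sub_self]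
      · rw [hc.2 j hj, hd.2 j hj, mul_zero, sub_zero]
  rw [key.pcov_eq hpd, sub_vecMul, smul_vecMul, Pi.sub_apply, Pi.smul_apply, smul_eq_mul,
    ← hc', ← hd']
  ring

lemma pcov_self_nonneg (hpd : S.PosDef) (hsym : S.IsSymm) (u : V) (Z : Finset V) :
    0 ≤ pcov S u u Z := by
  by_cases hu : u ∈ Z
  · exact (pcov_eq_zero_of_mem_left hpd hsym u hu).ge
  · exact (pcov_self_pos hpd hu).le

lemma rho2_nonneg (hpd : S.PosDef) (hsym : S.IsSymm) (u v : V) (Z : Finset V) :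
    0 ≤ rho2 S u v Z :=
  div_nonneg (sq_nonneg _)
    (mul_nonneg (pcov_self_nonneg hpd hsym u Z) (pcov_self_nonneg hpd hsym v Z))

lemma pcov_sq_le (hpd : S.PosDef) (hsym : S.IsSymm) (u : V) {w : V} {Z : Finset V} (hw : w ∉ Z) :
    pcov S u w Z ^ 2 ≤ pcov S u u Z * pcov S w w Z := by
  have h := pcov_self_nonneg hpd hsym u (insert w Z)
  rw [pcov_insert hpd u u hw, pcov_comm hpd hsym w u, sub_nonneg,
    div_le_iff₀ (pcov_self_pos hpd hw), ← sq] at h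
  exact h

lemma pcov_union_eq (hpd : S.PosDef) {u : V} {T W : Finset V}
    (h : ∀ w ∈ W, pcov S u w T = 0) (v : V) : pcov S u v (T ∪ W) = pcov S u v T := by
  induction W using Finset.induction_on generalizing v with
  | empty => simp
  | insert w W _ ih =>
    have ih := ih fun x hx => h x (Finset.mem_insert_of_mem hx)
    rw [Finset.union_insert]
    by_cases hw : w ∈ T ∪ W
    · rw [Finset.insert_eq_of_mem hw, ih]
    · rw [pcov_insert hpd u v hw, ih w, h w (Finset.mem_insert_self w W), ih]
      simp

end PartialCovariance

lemma Separates.exists_mem_support {W : Type*} {G : SimpleGraph W} {A C T : Set W}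
    (h : Separates G A C T) {a c : W} (ha : a ∈ A) (hc : c ∈ C) (p : G.Walk a c) :
    ∃ s ∈ T, s ∈ p.support := by
  classical
  obtain ⟨s, hs, hs'⟩ := h ha hc p.toPath p.toPath.2
  exact ⟨s, hs, p.support_toPath_subset_support hs'⟩

lemma Separates.mono {W : Type*} {G : SimpleGraph W} {A C T A' C' T' : Set W}
    (h : Separates G A C T) (hA : A' ⊆ A) (hC : C' ⊆ C) (hT : T ⊆ T') :
    Separates G A' C' T' := fun _ ha _ hc p hp =>
  let ⟨s, hs, hs'⟩ := h (hA ha) (hC hc) p hp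
  ⟨s, hT hs, hs'⟩

namespace SimpleGraph

variable {G : SimpleGraph V}

lemma Walk.IsPath.append_of_disjoint {u v w : V} {p : G.Walk u v} {q : G.Walk v w}
    (hp : p.IsPath) (hq : q.IsPath) (h : ∀ x ∈ p.support, x ∈ q.support → x = v) :
    (p.append q).IsPath := by
  have hq' := hq.support_nodup
  rw [← q.cons_tail_support, List.nodup_cons] at hq'
  rw [Walk.isPath_def, Walk.support_append]
  refine hp.support_nodup.append hq'.2 fun x hx hx' => ?_
  obtain rfl := h x hx (List.mem_of_mem_tail hx')
  exact hq'.1 hx'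

lemma Walk.exists_isPath_to_first_mem {u v : V} (p : G.Walk u v) (T : Set V) (hv : v ∈ T) :
    ∃ x ∈ T, ∃ r : G.Walk u x, r.IsPath ∧ ∀ y ∈ r.support, y ∈ T → y = x := by
  classical
  suffices ∃ x ∈ T, ∃ r : G.Walk u x, ∀ y ∈ r.support, y ∈ T → y = x by
    obtain ⟨x, hx, r, hr⟩ := this
    exact ⟨x, hx, r.toPath, r.toPath.2, fun y hy => hr y (r.support_toPath_subset_support hy)⟩
  induction p with
  | nil => exact ⟨_, hv, .nil, by simp⟩
  | @cons u w v h q ih =>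
    by_cases hu : u ∈ T
    · exact ⟨u, hu, .nil, by simp⟩
    · obtain ⟨x, hx, r, hr⟩ := ih hv
      refine ⟨x, hx, .cons h r, fun y hy hyT => ?_⟩
      rw [Walk.support_cons, List.mem_cons] at hy
      rcases hy with rfl | hy
      · exact absurd hyT hu
      · exact hr y hy hyT

lemma IsAcyclic.separates_of_mem_support (hG : G.IsAcyclic) {u v x : V} {p : G.Walk u v}
    (hp : p.IsPath) (hx : x ∈ p.support) {T : Set V} (hT : x ∈ T) : Separates G {u} {v} T := by
  rintro _ rfl _ rfl q hq
  have : q = p := congrArg Subtype.val ((hG.subsingleton_path _ _).elim ⟨q, hq⟩ ⟨p, hp⟩)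
  exact ⟨x, hT, this ▸ hx⟩

/-- In a tree, every vertex projects to a vertex of a given path. -/
lemma IsTree.exists_mem_support_separates (hG : G.IsTree) {a c : V} {p : G.Walk a c}
    (hp : p.IsPath) (w : V) : ∃ x ∈ p.support, ∀ T : Set V, x ∈ T →
      Separates G {a} {c} T ∧ Separates G {a} {w} T ∧ Separates G {c} {w} T := by
  classical
  obtain ⟨q⟩ := hG.connected.preconnected w a
  obtain ⟨x, hx, r, hr, hrx⟩ := q.exists_isPath_to_first_mem {y | y ∈ p.support} p.start_mem_support
  refine ⟨x, hx, fun T hT => ⟨hG.isAcyclic.separates_of_mem_support hp hx hT, ?_, ?_⟩⟩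
  · have h : ((p.takeUntil x hx).append r.reverse).IsPath :=
      (hp.takeUntil hx).append_of_disjoint hr.reverse fun y hy hy' =>
        hrx y (by simpa using hy') (p.support_takeUntil_subset_support hx hy)
    exact hG.isAcyclic.separates_of_mem_support h (by simp) hT
  · have h : ((p.dropUntil x hx).reverse.append r.reverse).IsPath :=
      (hp.dropUntil hx).reverse.append_of_disjoint hr.reverse fun y hy hy' =>
        hrx y (by simpa using hy') (p.support_dropUntil_subset_support hx (by simpa using hy))
    exact hG.isAcyclic.separates_of_mem_support h (by simp) hT

end SimpleGraph

/-- If `x` separates `a`, `c` and `w` pairwise, then conditioning on `w` can only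
decrease the squared correlation of `a` and `c`. -/
lemma sq_div_le_of_factor {A C W Q x y z : ℝ} (hA : 0 < A) (hC : 0 < C) (hW : 0 < W) (hQ : 0 < Q)
    (hx : x ^ 2 ≤ A * Q) (hy : y ^ 2 ≤ C * Q) (hz : z ^ 2 ≤ W * Q)
    (hA' : 0 < A - (x * z / Q) * (x * z / Q) / W) (hC' : 0 < C - (y * z / Q) * (y * z / Q) / W) :
    (x * y / Q - (x * z / Q) * (y * z / Q) / W) ^ 2 /
      ((A - (x * z / Q) * (x * z / Q) / W) * (C - (y * z / Q) * (y * z / Q) / W)) ≤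
    (x * y / Q) ^ 2 / (A * C) := by
  obtain ⟨t, ht⟩ : ∃ t, t = z ^ 2 / (W * Q) := ⟨_, rfl⟩
  have ht0 : 0 ≤ t := by rw [ht]; positivity
  have ht1 : t ≤ 1 := by rw [ht]; exact (div_le_one (by positivity)).2 hz
  have e (p q : ℝ) : p * z / Q * (q * z / Q) / W = p * q / Q * t := by rw [ht]; field_simp
  have hx' : x * x / Q ≤ A := by rw [div_le_iff₀ hQ]; linarith
  have hy' : y * y / Q ≤ C := by rw [div_le_iff₀ hQ]; linarith
  rw [e] at hA' hC' ⊢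
  rw [e, e, div_le_div_iff₀ (mul_pos hA' hC') (mul_pos hA hC)]
  have h1 : A * (1 - t) ≤ A - x * x / Q * t := by nlinarith
  have h2 : C * (1 - t) ≤ C - y * y / Q * t := by nlinarith
  have h3 := mul_le_mul h1 h2 (mul_nonneg hC.le (sub_nonneg.2 ht1)) hA'.le
  have h4 := mul_le_mul_of_nonneg_left h3 (sq_nonneg (x * y / Q))
  calc _ = (x * y / Q) ^ 2 * (A * (1 - t) * (C * (1 - t))) := by ring
    _ ≤ _ := h4

section Markov

variable [Fintype V] [DecidableEq V] {G : SimpleGraph V} {S : Matrix V V ℝ}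

lemma MarkovTree.pcov_eq_zero (hM : MarkovTree G S) (hpd : S.PosDef) (hsym : S.IsSymm)
    {u v : V} {Z : Finset V} (h : Separates G {u} {v} (Z : Set V)) : pcov S u v Z = 0 := by
  by_cases hu : u ∈ Z
  · exact pcov_eq_zero_of_mem_left hpd hsym v hu
  by_cases hv : v ∈ Z
  · rw [pcov_comm hpd hsym, pcov_eq_zero_of_mem_left hpd hsym u hv]
  refine hM u v ?_ Z hu hv h
  rintro rfl
  obtain ⟨s, hs, hs'⟩ := h rfl rfl .nil .nil
  rw [SimpleGraph.Walk.support_nil, List.mem_singleton] at hs'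
  exact hu (hs' ▸ hs)

lemma MarkovTree.pcov_factor (hM : MarkovTree G S) (hpd : S.PosDef) (hsym : S.IsSymm)
    {u v x : V} {Z : Finset V} (hx : x ∉ Z)
    (h : Separates G {u} {v} (insert x Z : Finset V)) :
    pcov S u v Z = pcov S u x Z * pcov S v x Z / pcov S x x Z := by
  have := hM.pcov_eq_zero hpd hsym h
  rwa [pcov_insert hpd u v hx, sub_eq_zero, pcov_comm hpd hsym x v] at this

lemma MarkovTree.rho2_insert_le (hM : MarkovTree G S) (hpd : S.PosDef) (hsym : S.IsSymm)
    (hG : G.IsTree) {a c w : V} {Z : Finset V} {p : G.Walk a c} (hp : p.IsPath)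
    (hpZ : ∀ x ∈ p.support, x ∉ insert w Z) : rho2 S a c (insert w Z) ≤ rho2 S a c Z := by
  by_cases hw : w ∈ Z
  · rw [Finset.insert_eq_of_mem hw]
  obtain ⟨x, hxp, hx⟩ := hG.exists_mem_support_separates hp w
  have hxZ : x ∉ Z := fun h => hpZ x hxp (Finset.mem_insert_of_mem h)
  have ha := hpZ a p.start_mem_support
  have hc := hpZ c p.end_mem_support
  have haZ : a ∉ Z := fun h => ha (Finset.mem_insert_of_mem h)
  have hcZ : c ∉ Z := fun h => hc (Finset.mem_insert_of_mem h)
  obtain ⟨h1, h2, h3⟩ := hx (insert x Z : Finset V) (by simp)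
  have e1 := hM.pcov_factor hpd hsym hxZ h1
  have e2 := hM.pcov_factor hpd hsym hxZ h2
  have e3 := hM.pcov_factor hpd hsym hxZ h3
  have ha' := pcov_self_pos hpd ha
  have hc' := pcov_self_pos hpd hc
  rw [pcov_insert hpd a a hw, pcov_comm hpd hsym w a, e2] at ha'
  rw [pcov_insert hpd c c hw, pcov_comm hpd hsym w c, e3] at hc'
  rw [rho2, rho2, pcov_insert hpd a c hw, pcov_insert hpd a a hw, pcov_insert hpd c c hw,
    pcov_comm hpd hsym w a, pcov_comm hpd hsym w c, e1, e2, e3]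
  exact sq_div_le_of_factor (pcov_self_pos hpd haZ) (pcov_self_pos hpd hcZ)
    (pcov_self_pos hpd hw) (pcov_self_pos hpd hxZ) (pcov_sq_le hpd hsym a hxZ)
    (pcov_sq_le hpd hsym c hxZ) (pcov_sq_le hpd hsym w hxZ) ha' hc'

lemma MarkovTree.rho2_union_le (hM : MarkovTree G S) (hpd : S.PosDef) (hsym : S.IsSymm)
    (hG : G.IsTree) {a c : V} {Z W : Finset V} {p : G.Walk a c} (hp : p.IsPath)
    (hpZ : ∀ x ∈ p.support, x ∉ Z) (hpW : ∀ x ∈ p.support, x ∉ W) :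
    rho2 S a c (W ∪ Z) ≤ rho2 S a c Z := by
  induction W using Finset.induction_on with
  | empty => simp
  | insert w W _ ih =>
    simp only [Finset.mem_insert, not_or] at hpW
    rw [Finset.insert_union]
    refine (hM.rho2_insert_le hpd hsym hG hp fun x hx => ?_).trans (ih fun x hx => (hpW x hx).2)
    simp [hpW x hx, hpZ x hx]

lemma MarkovTree.rho2_le_of_separates (hM : MarkovTree G S) (hpd : S.PosDef) (hsym : S.IsSymm)
    {a c c' : V} {Z : Finset V} (ha : a ∉ Z) (hc : c ∉ Z) (hc' : c' ∉ Z)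
    (h : Separates G {a} {c'} (insert c Z : Finset V)) : rho2 S a c' Z ≤ rho2 S a c Z := by
  have hA := pcov_self_pos hpd ha
  have hC := pcov_self_pos hpd hc
  have hC' := pcov_self_pos hpd hc'
  have hcs := pcov_sq_le hpd hsym c' hc
  rw [rho2, rho2, hM.pcov_factor hpd hsym hc h,
    div_le_div_iff₀ (mul_pos hA hC') (mul_pos hA hC), div_pow, mul_pow, div_mul_eq_mul_div,
    div_le_iff₀ (by positivity)]
  have := mul_le_mul_of_nonneg_left hcs
    (mul_nonneg (sq_nonneg (pcov S a c Z)) (mul_pos hA hC).le)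
  linarith

end Markov

/-- Corollary 3: on a Gaussian tree, if `c ∈ path(a,c')` and
`Z'` separates `{a,c'}` from `Z`, then `ρ²_{ac'|Z'} ≤ ρ²_{ac|Z}`. -/
theorem stmt_17 [Fintype V] [DecidableEq V] [Nonempty V]
    (G : SimpleGraph V) (hG : G.IsTree)
    (S : Matrix V V ℝ) (hsym : S.IsSymm) (hpd : S.PosDef) (hM : MarkovTree G S)
    (a c c' : V) (hac : a ≠ c) (hac' : a ≠ c') (hcc' : c ≠ c')
    (hpath : OnPath G a c' c)
    (Z Z' : Finset V)
    (haZ : a ∉ Z) (hcZ : c ∉ Z) (hc'Z : c' ∉ Z)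
    (haZ' : a ∉ Z') (hcZ' : c ∉ Z') (hc'Z' : c' ∉ Z')
    (hsep : Separates G {a, c'} (↑Z : Set V) (↑Z' : Set V)) :
    rho2 S a c' Z' ≤ rho2 S a c Z := by
  obtain ⟨p, hp, hcp⟩ := hpath
  by_cases hpZ' : ∃ x ∈ p.support, x ∈ Z'
  · obtain ⟨x, hx, hxZ'⟩ := hpZ'
    have h := hM.pcov_eq_zero hpd hsym (hG.isAcyclic.separates_of_mem_support hp hx
      (Finset.mem_coe.2 hxZ'))
    rw [rho2, h]
    simpa using rho2_nonneg hpd hsym a c Z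
  push Not at hpZ'
  refine (hM.rho2_le_of_separates hpd hsym haZ' hcZ' hc'Z'
    (hG.isAcyclic.separates_of_mem_support hp hcp (by simp))).trans ?_
  let q := p.takeUntil c hcp
  have hqZ' : ∀ x ∈ q.support, x ∉ Z' := fun x hx =>
    hpZ' x (p.support_takeUntil_subset_support hcp hx)
  have hcZsep : Separates G {c} (↑Z : Set V) (↑Z' : Set V) := by
    rintro _ rfl z hz r -
    obtain ⟨s, hs, hs'⟩ := hsep.exists_mem_support (Set.mem_insert a {c'}) hz (q.append r)
    rcases (SimpleGraph.Walk.mem_support_append_iff _ _).1 hs' with h | h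
    · exact absurd hs (hqZ' s h)
    · exact ⟨s, hs, h⟩
  have hqZ : ∀ x ∈ q.support, x ∉ Z := fun x hx hxZ => by
    obtain ⟨s, hs, hs'⟩ := hsep.exists_mem_support (Set.mem_insert a {c'}) hxZ (q.takeUntil x hx)
    exact hqZ' s (q.support_takeUntil_subset_support hx hs') hs
  have ea := pcov_union_eq hpd (u := a) (T := Z') (W := Z) fun w hw =>
    hM.pcov_eq_zero hpd hsym (hsep.mono (by simp) (by simpa using hw) subset_rfl)
  have ec := pcov_union_eq hpd (u := c) (T := Z') (W := Z) fun w hw =>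
    hM.pcov_eq_zero hpd hsym (hcZsep.mono subset_rfl (by simpa using hw) subset_rfl)
  have e : rho2 S a c Z' = rho2 S a c (Z' ∪ Z) := by rw [rho2, rho2, ea, ea, ec]
  rw [e]
  exact hM.rho2_union_le hpd hsym hG (hp.takeUntil hcp) hqZ hqZ'
end
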